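/- arXiv:1208.5190 — 2 statements merged into one kernel-verified Lean document; each statement's English description precedes it below -/
import Mathlib

section
/- Let F ∈ 𝒫. Let x and s be integers with 0 ≤ x < q and 0 ≤ s < q, let r ∈ {0,1} ⊆ K ⊆ L, let V, W ∈ K[t] be the unique polynomials with deg V, deg W < n, V(g) = g^s and W(g) = g^(x·s)·(F(g) + r), and let u ≥ 0 be an integer with g^u ∈ D_x, with Frobenius orbit D_u = {g^(u·2^j) : 0 ≤ j < n}. Then either V(β) = 0 for every β ∈ D_u, or the set {β ∈ D_u : W(β) + V(β)^x·(F(β) + r) = 0} has at most one element. -/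
open Polynomial

/-- The Frobenius orbit `D_u = {g^(u·2^j) : 0 ≤ j < n}` of `g^u`. -/
def gOrbit {L : Type*} [Monoid L] (n : ℕ) (g : L) (u : ℕ) : Set L :=
  {γ | ∃ j < n, γ = g ^ (u * 2 ^ j)}

/-- The set `𝒫` of polynomials over `L` with one coefficient of multiplicative order
`2^n − 1` and all other coefficients in `K = GF(2)`. -/
def PolySet (L : Type*) [Field L] [Algebra (ZMod 2) L] (n : ℕ) : Set (Polynomial L) :=
  {F | ∃ l, orderOf (F.coeff l) = 2 ^ n - 1 ∧
        ∀ k, k ≠ l → F.coeff k ∈ Set.range (algebraMap (ZMod 2) L)}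

theorem PolySet.exists_eq_map_add_monomial {L : Type*} [Field L] [Algebra (ZMod 2) L] {n : ℕ}
    {F : Polynomial L} (hF : F ∈ PolySet L n) :
    ∃ (P : Polynomial (ZMod 2)) (l : ℕ) (a : L), orderOf a = 2 ^ n - 1 ∧
      F = P.map (algebraMap (ZMod 2) L) + monomial l a := by
  obtain ⟨l, hl, hk⟩ := hF
  have hlift : F - monomial l (F.coeff l) ∈ lifts (algebraMap (ZMod 2) L) := by
    rw [lifts_iff_coeff_lifts]
    intro k
    rw [coeff_sub, coeff_monomial]
    by_cases h : l = k
    · exact ⟨0, by simp [h]⟩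
    · simpa [h] using hk k (Ne.symm h)
  obtain ⟨P, hP⟩ := (mem_lifts _).1 hlift
  exact ⟨P, l, F.coeff l, hl, by rw [hP]; ring⟩

theorem aeval_pow_two_pow {L : Type*} [Field L] [Algebra (ZMod 2) L]
    (P : Polynomial (ZMod 2)) (b : L) (j : ℕ) :
    aeval (b ^ 2 ^ j) P = aeval b P ^ 2 ^ j := by
  induction j with
  | zero => simp
  | succ j ih => rw [pow_succ, pow_mul, ← expand_aeval, ZMod.expand_card, map_pow, ih, ← pow_mul]

/-- The exponents `2 ^ (n - j)` with `j < n` are distinct modulo `2 ^ n - 1`. -/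
theorem eq_of_pow_two_pow_sub_eq {M : Type*} [CancelMonoid M] {a : M} {n i j : ℕ}
    (ha : orderOf a = 2 ^ n - 1) (hi : i < n) (hj : j < n)
    (h : a ^ 2 ^ (n - i) = a ^ 2 ^ (n - j)) : i = j := by
  rw [pow_eq_pow_iff_modEq, ha] at h
  have bound : ∀ k < n, 2 ≤ 2 ^ (n - k) ∧ 2 ^ (n - k) ≤ 2 ^ n := fun k hk =>
    ⟨Nat.le_self_pow (by omega) 2, Nat.pow_le_pow_right two_pos (by omega)⟩
  obtain ⟨hi₁, hi₂⟩ := bound i hi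
  obtain ⟨hj₁, hj₂⟩ := bound j hj
  have hexp : 2 ^ (n - i) = 2 ^ (n - j) := by
    rcases le_total (2 ^ (n - i)) (2 ^ (n - j)) with hle | hle
    · have := Nat.eq_zero_of_dvd_of_lt ((Nat.modEq_iff_dvd' hle).1 h) (by omega)
      omega
    · have := Nat.eq_zero_of_dvd_of_lt ((Nat.modEq_iff_dvd' hle).1 h.symm) (by omega)
      omega
  have := Nat.pow_right_injective le_rfl hexp
  omega

/-- For `F ∈ 𝒫`: either `V` vanishes on the whole Frobenius orbit `D_u`, or
`{β ∈ D_u : W(β) + V(β)^x·(F(β) + r) = 0}` has at most one element. -/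
theorem stmt3 {L : Type*} [Field L] [Fintype L] [Algebra (ZMod 2) L]
    (n : ℕ) (hn : 2 ≤ n) (hcard : Fintype.card L = 2 ^ n)
    (g : L) (hg : orderOf g = 2 ^ n - 1)
    (F : Polynomial L) (hF : F ∈ PolySet L n)
    (x s : ℕ) (hx : x < 2 ^ n - 1) (hs : s < 2 ^ n - 1)
    (r : L) (hr : r = 0 ∨ r = 1)
    (Y V W : Polynomial (ZMod 2))
    (hYdeg : Y.degree < (n : WithBot ℕ)) (hYg : aeval g Y = g ^ x)
    (hVdeg : V.degree < (n : WithBot ℕ)) (hVg : aeval g V = g ^ s)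
    (hWdeg : W.degree < (n : WithBot ℕ))
    (hWg : aeval g W = g ^ (x * s) * (Polynomial.eval g F + r))
    (u : ℕ) (hu : g ^ u ≠ 0 ∧ aeval (g ^ u) Y = (g ^ u) ^ x) :
    (∀ β ∈ gOrbit n g u, aeval β V = 0) ∨
      {β ∈ gOrbit n g u |
        aeval β W + (aeval β V) ^ x * (Polynomial.eval β F + r) = 0}.Subsingleton := by
  obtain ⟨P, l, a, ha, rfl⟩ := PolySet.exists_eq_map_add_monomial hF
  have hchar : CharP L 2 := charP_of_injective_algebraMap (algebraMap (ZMod 2) L).injective 2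
  obtain ⟨r', rfl⟩ : ∃ r' : ZMod 2, algebraMap (ZMod 2) L r' = r := by
    rcases hr with rfl | rfl
    exacts [⟨0, map_zero _⟩, ⟨1, map_one _⟩]
  set b := g ^ u with hb
  by_cases hV : aeval b V = 0
  · left
    rintro _ ⟨j, -, rfl⟩
    rw [pow_mul, ← hb, aeval_pow_two_pow, hV, zero_pow (by positivity)]
  right
  have fixed : ∀ (y : L) (j : ℕ), j < n → (y ^ 2 ^ j) ^ 2 ^ (n - j) = y := fun y j hj => by
    rw [← pow_mul, ← pow_add, Nat.add_sub_cancel' hj.le, ← hcard, FiniteField.pow_card]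
  have key : ∀ j < n, aeval (g ^ (u * 2 ^ j)) W + (aeval (g ^ (u * 2 ^ j)) V) ^ x *
      (eval (g ^ (u * 2 ^ j)) (P.map (algebraMap (ZMod 2) L) + monomial l a)
        + algebraMap (ZMod 2) L r') = 0 →
      aeval b W + aeval b V ^ x * (aeval b (P + C r') + a ^ 2 ^ (n - j) * b ^ l) = 0 := by
    intro j hj h
    have hF' : eval (b ^ 2 ^ j) (P.map (algebraMap (ZMod 2) L) + monomial l a)
        + algebraMap (ZMod 2) L r' = aeval b (P + C r') ^ 2 ^ j + a * (b ^ l) ^ 2 ^ j := by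
      rw [← aeval_pow_two_pow, map_add, aeval_C, eval_add, eval_monomial, eval_map_algebraMap,
        pow_right_comm]
      ring
    rw [pow_mul, ← hb, hF', aeval_pow_two_pow, aeval_pow_two_pow] at h
    have h' := congrArg (· ^ 2 ^ (n - j)) h
    simp only [add_pow_char_pow, mul_pow, zero_pow (pow_ne_zero _ (two_ne_zero' ℕ)),
      pow_right_comm _ (2 ^ j) x, fixed _ j hj] at h'
    exact h'
  rintro _ ⟨⟨i, hi, rfl⟩, h₁⟩ _ ⟨⟨j, hj, rfl⟩, h₂⟩
  have h := add_left_cancel ((key i hi h₁).trans (key j hj h₂).symm)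
  have h := add_left_cancel (mul_left_cancel₀ (pow_ne_zero x hV) h)
  have h := mul_right_cancel₀ (pow_ne_zero l hu.1) h
  have ha0 : a ≠ 0 := by
    rintro rfl
    have : 2 ^ 2 ≤ 2 ^ n := Nat.pow_le_pow_right two_pos hn
    rw [orderOf_zero] at ha
    omega
  rw [eq_of_pow_two_pow_sub_eq (a := Units.mk0 a ha0) (by rw [← orderOf_units, Units.val_mk0, ha])
    hi hj (Units.ext (by simpa using h))]
end

section
/- Let n ≥ 3 be an integer and let ξ ∈ Φ_n satisfy φ_n(ξ) = ω(n). If there is an integer h with 1 < h < n and 0 < ξ_h < N₂(h), then h·(ξ_1 + ξ_2 + ⋯ + ξ_n) = 1·ξ_1 + 2·ξ_2 + ⋯ + n·ξ_n; in particular ω(n) = 1/h. -/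
/-- `N₂(d)`: the number of monic irreducible polynomials of degree `d` over `GF(2)`. -/
noncomputable def N2 (d : ℕ) : ℕ :=
  Set.ncard {P : Polynomial (ZMod 2) | P.Monic ∧ Irreducible P ∧ P.natDegree = d}

/-- The set `Φ_n` of integer tuples. -/
def PhiSet (n : ℕ) : Set (ℕ → ℕ) :=
  {z | z 1 ≤ 1 ∧ (∀ d, 1 < d → d < n → z d ≤ N2 d) ∧ 1 ≤ z n ∧ z n ≤ N2 n}

/-- `φ_n(z) = (z_1 + ⋯ + z_n)/(1·z_1 + ⋯ + n·z_n)` as a rational number. -/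
def phiFn (n : ℕ) (z : ℕ → ℕ) : ℚ :=
  (∑ d ∈ Finset.Icc 1 n, (z d : ℚ)) / (∑ d ∈ Finset.Icc 1 n, (d : ℚ) * (z d : ℚ))

theorem sum_mul_update {n h : ℕ} (hh : h ∈ Finset.Icc 1 n) (c : ℕ → ℚ) (z : ℕ → ℕ) (k : ℕ) :
    ∑ d ∈ Finset.Icc 1 n, c d * (Function.update z h k d : ℚ) =
      ∑ d ∈ Finset.Icc 1 n, c d * (z d : ℚ) + c h * ((k : ℚ) - z h) := by
  rw [← sub_eq_iff_eq_add', ← Finset.sum_sub_distrib, Finset.sum_eq_single_of_mem h hh]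
  · simp [mul_sub]
  · intro d _ hd
    simp [hd]

theorem sum_update {n h : ℕ} (hh : h ∈ Finset.Icc 1 n) (z : ℕ → ℕ) (k : ℕ) :
    ∑ d ∈ Finset.Icc 1 n, (Function.update z h k d : ℚ) =
      ∑ d ∈ Finset.Icc 1 n, (z d : ℚ) + ((k : ℚ) - z h) := by
  simpa using sum_mul_update hh (fun _ => 1) z k

theorem update_mem_PhiSet {n h k : ℕ} {z : ℕ → ℕ} (hz : z ∈ PhiSet n) (h1 : 1 < h) (h2 : h < n)
    (hk : k ≤ N2 h) : Function.update z h k ∈ PhiSet n := by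
  obtain ⟨hz1, hzd, hzn, hzn'⟩ := hz
  refine ⟨by rwa [Function.update_of_ne h1.ne], fun d hd hd' => ?_, ?_, ?_⟩
  · rcases eq_or_ne d h with rfl | hne
    · rwa [Function.update_self]
    · rw [Function.update_of_ne hne]
      exact hzd d hd hd'
  · rwa [Function.update_of_ne h2.ne']
  · rwa [Function.update_of_ne h2.ne']

theorem weighted_sum_pos {n : ℕ} (hn : 0 < n) {z : ℕ → ℕ} (hz : z ∈ PhiSet n) :
    0 < ∑ d ∈ Finset.Icc 1 n, (d : ℚ) * (z d : ℚ) := by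
  refine Finset.sum_pos' (fun d _ => by positivity) ⟨n, Finset.mem_Icc.2 ⟨hn, le_rfl⟩, ?_⟩
  have hzn : 0 < z n := hz.2.2.1
  positivity

/-- Replacing the `h`-th coordinate of a maximizer of `φ_n` by `k` does not increase `φ_n`;
clearing denominators gives a linear inequality in `k - z_h`. -/
theorem sub_mul_le_of_isMax {n h k : ℕ} {z : ℕ → ℕ} (hz : z ∈ PhiSet n)
    (hmax : ∀ y ∈ PhiSet n, phiFn n y ≤ phiFn n z) (h1 : 1 < h) (h2 : h < n) (hk : k ≤ N2 h) :
    ((k : ℚ) - z h) * ∑ d ∈ Finset.Icc 1 n, (d : ℚ) * (z d : ℚ) ≤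
      ((k : ℚ) - z h) * (h * ∑ d ∈ Finset.Icc 1 n, (z d : ℚ)) := by
  have hh : h ∈ Finset.Icc 1 n := Finset.mem_Icc.2 ⟨h1.le, h2.le⟩
  have hy := update_mem_PhiSet hz h1 h2 hk
  have hle := hmax _ hy
  have hpos := weighted_sum_pos (by omega) hy
  rw [phiFn, phiFn, div_le_div_iff₀ hpos (weighted_sum_pos (by omega) hz),
    sum_update hh, sum_mul_update hh (fun d => (d : ℚ))] at hle
  linarith

/-- If `ξ ∈ Φ_n` attains the maximum `ω(n)` and `0 < ξ_h < N₂(h)` for some `1 < h < n`, then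
`h·(ξ_1 + ⋯ + ξ_n) = 1·ξ_1 + ⋯ + n·ξ_n`; in particular `ω(n) = 1/h`. -/
theorem stmt10 (n : ℕ) (hn : 3 ≤ n)
    (ω : ℚ) (hω : IsGreatest (phiFn n '' PhiSet n) ω)
    (ξ : ℕ → ℕ) (hξ : ξ ∈ PhiSet n) (hmax : phiFn n ξ = ω)
    (h : ℕ) (h1 : 1 < h) (h2 : h < n) (h3 : 0 < ξ h) (h4 : ξ h < N2 h) :
    h * (∑ d ∈ Finset.Icc 1 n, ξ d) = ∑ d ∈ Finset.Icc 1 n, d * ξ d ∧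
      ω = 1 / (h : ℚ) := by
  have hle : ∀ y ∈ PhiSet n, phiFn n y ≤ phiFn n ξ := fun y hy =>
    hmax ▸ hω.2 (Set.mem_image_of_mem _ hy)
  have hup := sub_mul_le_of_isMax hξ hle h1 h2 (k := ξ h + 1) h4
  have hdown := sub_mul_le_of_isMax hξ hle h1 h2 (k := ξ h - 1) (by omega)
  rw [Nat.cast_sub h3] at hdown
  push_cast at hup hdown
  have heq : (h : ℚ) * ∑ d ∈ Finset.Icc 1 n, (ξ d : ℚ) =
      ∑ d ∈ Finset.Icc 1 n, (d : ℚ) * (ξ d : ℚ) := by linarith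
  refine ⟨by exact_mod_cast heq, ?_⟩
  have hpos := weighted_sum_pos (by omega) hξ
  have hh : (h : ℚ) ≠ 0 := by positivity
  rw [← hmax, phiFn, div_eq_div_iff hpos.ne' hh, ← heq]
  ring
end
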